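/- arXiv:2503.06180 — 2 statements merged into one kernel-verified Lean document; each statement's English description precedes it below -/
import Mathlib

section
/- Let μ and ν be integrable measures on ℝⁿ. Then P_S(μ⊛ν) = P_S(P_S(μ)⊛ν) = P_S(μ⊛P_S(ν)) = P_S(P_S(μ)⊛P_S(ν)). -/
open MeasureTheory
open scoped ENNReal symmDiff Classical

noncomputable section

/-- The Euclidean (ℓ²) norm on `Fin n → ℝ`. -/
def e2 {n : ℕ} (x : Fin n → ℝ) : ℝ := Real.sqrt (∑ i, (x i) ^ 2)

/-- The unit sphere `S^{n-1}` in `ℝⁿ`. -/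
def Sph (n : ℕ) : Set (Fin n → ℝ) := {x | e2 x = 1}

/-- The set `A_E = {x : xᵢ ≠ 0 ↔ i ∈ E}`. -/
def setA {n : ℕ} (E : Finset (Fin n)) : Set (Fin n → ℝ) := {x | ∀ i, x i ≠ 0 ↔ i ∈ E}

/-- Finite signed Borel measures on `ℝⁿ`. -/
abbrev SM (n : ℕ) := MeasureTheory.SignedMeasure (Fin n → ℝ)

/-- A (finite) measure regarded as a signed measure (junk value `0` if not finite). -/
def toSigned {X : Type*} [MeasurableSpace X] (ρ : Measure X) : SignedMeasure X :=
  if h : IsFiniteMeasure ρ then @Measure.toSignedMeasure X _ ρ h else 0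

/-- Multiplicative convolution of two non-negative measures. -/
def mconvPos {n : ℕ} (ρ σ : Measure (Fin n → ℝ)) : Measure (Fin n → ℝ) :=
  (ρ.prod σ).map (fun p => p.1 * p.2)

/-- Multiplicative convolution `μ ⊛ ν` of two signed measures, via Jordan decomposition. -/
def mconv {n : ℕ} (μ ν : SM n) : SM n :=
  toSigned (mconvPos μ.toJordanDecomposition.posPart ν.toJordanDecomposition.posPart
      + mconvPos μ.toJordanDecomposition.negPart ν.toJordanDecomposition.negPart)
  - toSigned (mconvPos μ.toJordanDecomposition.posPart ν.toJordanDecomposition.negPart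
      + mconvPos μ.toJordanDecomposition.negPart ν.toJordanDecomposition.posPart)

/-- `μ` is integrable: `∫ ‖x‖₂ d|μ| < ∞`. -/
def IntegrableSM {n : ℕ} (μ : SM n) : Prop :=
  ∫⁻ x, ENNReal.ofReal (e2 x) ∂μ.totalVariation < ⊤

/-- `μ` is concentrated on `A`:  `|μ|(Aᶜ) = 0`. -/
def ConcOn {n : ℕ} (μ : SM n) (A : Set (Fin n → ℝ)) : Prop := μ.totalVariation Aᶜ = 0

/-- The multiple reflection `T_E` on `ℝⁿ`. -/
def flipE {n : ℕ} (E : Finset (Fin n)) (x : Fin n → ℝ) : Fin n → ℝ :=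
  fun i => if i ∈ E then -x i else x i

/-- Pushforward of a signed measure under `T_E`. -/
def Tmap {n : ℕ} (E : Finset (Fin n)) (μ : SM n) : SM n := μ.map (flipE E)

def EvenUnder {n : ℕ} (μ : SM n) (E : Finset (Fin n)) : Prop := Tmap E μ = μ
def OddUnder {n : ℕ} (μ : SM n) (E : Finset (Fin n)) : Prop := Tmap E μ = -μ

/-- Orthogonal projection onto the coordinate subspace `H_E`. -/
def projE {n : ℕ} (E : Finset (Fin n)) (x : Fin n → ℝ) : Fin n → ℝ :=
  fun i => if i ∈ E then x i else 0

/-- `P_E(μ)`: pushforward under `projE`. -/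
def Pmap {n : ℕ} (E : Finset (Fin n)) (μ : SM n) : SM n := μ.map (projE E)

/-- `R_E(μ) = μ_E`: restriction to `A_E`. -/
def Rres {n : ℕ} (E : Finset (Fin n)) (μ : SM n) : SM n := μ.restrict (setA E)

/-- Sign vector attached to `b : Fin n → Bool`. -/
def signVec {n : ℕ} (b : Fin n → Bool) : Fin n → ℝ := fun i => if b i then 1 else -1

/-- The measure `δ_J = 2^{-n} ∑_{s ∈ 𝒮ⁿ} σ_J(s) δ_s`. -/
def deltaJ {n : ℕ} (J : Finset (Fin n)) : SM n :=
  ((2 : ℝ) ^ n)⁻¹ •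
    ∑ b : Fin n → Bool,
      (∏ j ∈ J, (if b j then (1 : ℝ) else -1)) • toSigned (Measure.dirac (signVec b))

/-- `𝒥(E; Fe, Fo)`. -/
def JsetE {n : ℕ} (E : Finset (Fin n)) (Fe Fo : Set (Finset (Fin n))) :
    Set (Finset (Fin n)) :=
  {J | J ⊆ E ∧ (∀ F ∈ Fe, Even (J ∩ F).card) ∧ (∀ F ∈ Fo, Odd (J ∩ F).card)}

/-- `𝒥(Fe, Fo) = 𝒥([n]; Fe, Fo)`. -/
def Jset {n : ℕ} (Fe Fo : Set (Finset (Fin n))) : Set (Finset (Fin n)) :=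
  {J | (∀ F ∈ Fe, Even (J ∩ F).card) ∧ (∀ F ∈ Fo, Odd (J ∩ F).card)}

/-- `G` has a representation `G = F₁ Δ … Δ F_m` with each `Fᵢ` drawn from `Fe` or `Fo`,
in which the number of terms drawn from `Fo` is even (`odd = false`) or odd (`odd = true`). -/
def HasRep {n : ℕ} (Fe Fo : Set (Finset (Fin n))) (G : Finset (Fin n)) (odd : Bool) : Prop :=
  ∃ l : List (Finset (Fin n) × Bool),
    (∀ p ∈ l, if p.2 then p.1 ∈ Fo else p.1 ∈ Fe) ∧
    (l.map Prod.fst).foldr (· ∆ ·) ∅ = G ∧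
    (l.countP (fun p => p.2)) % 2 = (if odd then 1 else 0)

/-- The generating pair `(Fe, Fo)` is proper: the even and odd parts of the generated group
are disjoint. -/
def ProperPair {n : ℕ} (Fe Fo : Set (Finset (Fin n))) : Prop :=
  ∀ G : Finset (Fin n), ¬ (HasRep Fe Fo G false ∧ HasRep Fe Fo G true)

/-- `ℳ^int(A; Fe, Fo)`: integrable signed measures concentrated on `A`, even under `T_F`
for `F ∈ Fe` and odd under `T_F` for `F ∈ Fo`. -/
def MclassInt {n : ℕ} (A : Set (Fin n → ℝ)) (Fe Fo : Set (Finset (Fin n))) : Set (SM n) :=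
  {μ | IntegrableSM μ ∧ ConcOn μ A ∧ (∀ F ∈ Fe, EvenUnder μ F) ∧ (∀ F ∈ Fo, OddUnder μ F)}

/-- `ν` is universal on `𝒜`. -/
def Universal {n : ℕ} (ν : SM n) (𝒜 : Set (SM n)) : Prop :=
  ∀ μ ∈ 𝒜, mconv ν μ = 0 → μ = 0

/-- Radial projection of a non-negative measure. -/
def radPos {n : ℕ} (ρ : Measure (Fin n → ℝ)) : Measure (Fin n → ℝ) :=
  (ρ.withDensity fun x => ENNReal.ofReal (e2 x)).map (fun x => (e2 x)⁻¹ • x)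

/-- Radial projection `P_S` of a signed measure. -/
def PS {n : ℕ} (μ : SM n) : SM n :=
  toSigned (radPos μ.toJordanDecomposition.posPart) -
    toSigned (radPos μ.toJordanDecomposition.negPart)

/-- The spherical product `μ ⊛_S ν = P_S(μ ⊛ ν)`. -/
def mconvS {n : ℕ} (μ ν : SM n) : SM n := PS (mconv μ ν)

/-- `ν` is spherically universal on `𝒜`. -/
def SphUniversal {n : ℕ} (ν : SM n) (𝒜 : Set (SM n)) : Prop :=
  ∀ μ ∈ 𝒜, mconvS ν μ = 0 → μ = 0

/-- The unconditional symmetrisation `M_unc`. -/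
def Munc {n : ℕ} (μ : SM n) : SM n := ((2 : ℝ) ^ n)⁻¹ • ∑ E : Finset (Fin n), Tmap E μ

/-- Integral of `f` against a signed measure. -/
def sInt {n : ℕ} (μ : SM n) (f : (Fin n → ℝ) → ℝ) : ℝ :=
  (∫ x, f x ∂μ.toJordanDecomposition.posPart) - ∫ x, f x ∂μ.toJordanDecomposition.negPart

/-- `δ₁ ⊗ μ`: the lifting of `μ` to a measure on `ℝ^{n+1}`, with an extra `0`-th coordinate
carrying a unit atom at `1`. -/
def lift0 {n : ℕ} (μ : SM n) : SM (n + 1) := μ.map (fun x => Fin.cons 1 x)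

/-- Symmetrisation about the origin. -/
def Msym {n : ℕ} (μ : SM n) : SM n := (2 : ℝ)⁻¹ • (μ + μ.map (fun x => -x))

/-- The lifting `L(μ) = P_S(M_sym(δ₁ ⊗ μ))`. -/
def Lift {n : ℕ} (μ : SM n) : SM (n + 1) := PS (Msym (lift0 μ))


section SignedDifferences

variable {X : Type*} [MeasurableSpace X]

lemma toSigned_eq (ρ : Measure X) [h : IsFiniteMeasure ρ] : toSigned ρ = ρ.toSignedMeasure :=
  dif_pos h

lemma toSigned_sub_eq_iff (a b c d : Measure X) [IsFiniteMeasure a] [IsFiniteMeasure b]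
    [IsFiniteMeasure c] [IsFiniteMeasure d] :
    toSigned a - toSigned b = toSigned c - toSigned d ↔ a + d = c + b := by
  rw [← Measure.toSignedMeasure_eq_toSignedMeasure_iff, Measure.toSignedMeasure_add,
    Measure.toSignedMeasure_add]
  simp only [toSigned_eq]
  exact sub_eq_sub_iff_add_eq_add

lemma toSigned_posPart_sub_negPart (μ : SignedMeasure X) :
    toSigned μ.toJordanDecomposition.posPart - toSigned μ.toJordanDecomposition.negPart = μ := by
  simp only [toSigned_eq]
  exact μ.toSignedMeasure_toJordanDecomposition

lemma add_negPart_eq (a b : Measure X) [IsFiniteMeasure a] [IsFiniteMeasure b] :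
    a + (toSigned a - toSigned b).toJordanDecomposition.negPart =
      (toSigned a - toSigned b).toJordanDecomposition.posPart + b :=
  (toSigned_sub_eq_iff _ _ _ _).1 (toSigned_posPart_sub_negPart _).symm

lemma le_of_mutuallySingular_of_add_eq {p m a b : Measure X} (hs : p ⟂ₘ m)
    (h : a + m = p + b) : p ≤ a ∧ m ≤ b := by
  obtain ⟨s, hs, hp, hm⟩ := hs
  constructor
  · have hp' : p.restrict sᶜ = p := Measure.restrict_eq_self_of_ae_mem (by
      rw [ae_iff]; simpa using hp)
    have hm' : m.restrict sᶜ = 0 := Measure.restrict_eq_zero.2 hm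
    calc p = p.restrict sᶜ := hp'.symm
      _ ≤ (p + b).restrict sᶜ := Measure.restrict_mono le_rfl (Measure.le_add_right le_rfl)
      _ = a.restrict sᶜ := by rw [← h, Measure.restrict_add, hm', add_zero]
      _ ≤ a := Measure.restrict_le_self
  · have hm' : m.restrict s = m := Measure.restrict_eq_self_of_ae_mem hm
    have hp' : p.restrict s = 0 := Measure.restrict_eq_zero.2 hp
    calc m = m.restrict s := hm'.symm
      _ ≤ (a + m).restrict s := Measure.restrict_mono le_rfl (Measure.le_add_left le_rfl)
      _ = b.restrict s := by rw [h, Measure.restrict_add, hp', zero_add]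
      _ ≤ b := Measure.restrict_le_self

end SignedDifferences

section EuclideanNorm

variable {n : ℕ}

lemma e2_nonneg (x : Fin n → ℝ) : 0 ≤ e2 x := Real.sqrt_nonneg _

@[fun_prop]
lemma measurable_e2 : Measurable (e2 : (Fin n → ℝ) → ℝ) := by
  unfold e2; fun_prop

lemma e2_smul (c : ℝ) (x : Fin n → ℝ) : e2 (c • x) = |c| * e2 x := by
  simp only [e2, Pi.smul_apply, smul_eq_mul, mul_pow, ← Finset.mul_sum]
  rw [Real.sqrt_mul (sq_nonneg c), Real.sqrt_sq_eq_abs]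

lemma eq_zero_of_e2_eq_zero {x : Fin n → ℝ} (h : e2 x = 0) : x = 0 := by
  have h' : ∑ i, (x i) ^ 2 = 0 :=
    (Real.sqrt_eq_zero (Finset.sum_nonneg fun i _ => sq_nonneg (x i))).1 h
  rw [Finset.sum_eq_zero_iff_of_nonneg fun i _ => sq_nonneg (x i)] at h'
  ext i
  simpa using h' i (Finset.mem_univ i)

lemma e2_zero : e2 (0 : Fin n → ℝ) = 0 := by simp [e2]

lemma e2_mul_le (x y : Fin n → ℝ) : e2 (x * y) ≤ e2 x * e2 y := by
  unfold e2
  rw [← Real.sqrt_mul (Finset.sum_nonneg fun i _ => sq_nonneg (x i))]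
  apply Real.sqrt_le_sqrt
  rw [Finset.sum_mul]
  refine Finset.sum_le_sum fun i _ => ?_
  rw [Pi.mul_apply, mul_pow]
  exact mul_le_mul_of_nonneg_left
    (Finset.single_le_sum (f := fun j => y j ^ 2) (fun j _ => sq_nonneg (y j))
      (Finset.mem_univ i)) (sq_nonneg _)

end EuclideanNorm

section PositiveMeasures

variable {n : ℕ}

lemma mconvPos_add_left (a b c : Measure (Fin n → ℝ)) [IsFiniteMeasure a] [IsFiniteMeasure b]
    [IsFiniteMeasure c] : mconvPos (a + b) c = mconvPos a c + mconvPos b c := by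
  unfold mconvPos
  rw [Measure.add_prod, Measure.map_add _ _ (by fun_prop)]

lemma mconvPos_comm (a b : Measure (Fin n → ℝ)) [IsFiniteMeasure a] [IsFiniteMeasure b] :
    mconvPos a b = mconvPos b a := by
  unfold mconvPos
  rw [← Measure.prod_swap, Measure.map_map (by fun_prop) (by fun_prop)]
  congr 1
  ext p
  simp [mul_comm]

lemma mconvPos_add_right (a b c : Measure (Fin n → ℝ)) [IsFiniteMeasure a] [IsFiniteMeasure b]
    [IsFiniteMeasure c] : mconvPos a (b + c) = mconvPos a b + mconvPos a c := by
  unfold mconvPos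
  rw [Measure.prod_add, Measure.map_add _ _ (by fun_prop)]

instance (a b : Measure (Fin n → ℝ)) [IsFiniteMeasure a] [IsFiniteMeasure b] :
    IsFiniteMeasure (mconvPos a b) := by
  unfold mconvPos; infer_instance

lemma lintegral_mconvPos (a b : Measure (Fin n → ℝ)) [IsFiniteMeasure a] [IsFiniteMeasure b]
    {f : (Fin n → ℝ) → ℝ≥0∞} (hf : Measurable f) :
    ∫⁻ z, f z ∂(mconvPos a b) = ∫⁻ x, ∫⁻ y, f (x * y) ∂b ∂a := by
  unfold mconvPos
  rw [lintegral_map hf (by fun_prop), lintegral_prod _ (by fun_prop)]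

lemma radPos_add (a b : Measure (Fin n → ℝ)) : radPos (a + b) = radPos a + radPos b := by
  unfold radPos
  rw [withDensity_add_measure, Measure.map_add _ _ (by fun_prop)]

lemma lintegral_radPos (a : Measure (Fin n → ℝ)) {f : (Fin n → ℝ) → ℝ≥0∞} (hf : Measurable f) :
    ∫⁻ z, f z ∂(radPos a) = ∫⁻ x, ENNReal.ofReal (e2 x) * f ((e2 x)⁻¹ • x) ∂a := by
  unfold radPos
  rw [lintegral_map hf (by fun_prop),
    lintegral_withDensity_eq_lintegral_mul _ (by fun_prop) (by fun_prop)]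
  rfl

/-- Finite measures with finite first moment. -/
structure FiniteFirstMoment (ρ : Measure (Fin n → ℝ)) : Prop where
  finite : IsFiniteMeasure ρ
  moment : ∫⁻ x, ENNReal.ofReal (e2 x) ∂ρ < ⊤

namespace FiniteFirstMoment

variable {a b : Measure (Fin n → ℝ)}

lemma mono (hb : FiniteFirstMoment b) (h : a ≤ b) : FiniteFirstMoment a :=
  have := hb.finite
  ⟨isFiniteMeasure_of_le b h, (lintegral_mono' h le_rfl).trans_lt hb.moment⟩

lemma add (ha : FiniteFirstMoment a) (hb : FiniteFirstMoment b) : FiniteFirstMoment (a + b) :=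
  have := ha.finite
  have := hb.finite
  ⟨inferInstance, by
    rw [lintegral_add_measure]; exact ENNReal.add_lt_top.2 ⟨ha.moment, hb.moment⟩⟩

lemma mconvPos (ha : FiniteFirstMoment a) (hb : FiniteFirstMoment b) :
    FiniteFirstMoment (mconvPos a b) := by
  have := ha.finite
  have := hb.finite
  refine ⟨inferInstance, ?_⟩
  rw [lintegral_mconvPos a b (by fun_prop)]
  calc ∫⁻ x, ∫⁻ y, ENNReal.ofReal (e2 (x * y)) ∂b ∂a
      ≤ ∫⁻ x, ∫⁻ y, ENNReal.ofReal (e2 x) * ENNReal.ofReal (e2 y) ∂b ∂a := by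
        refine lintegral_mono fun x => lintegral_mono fun y => ?_
        rw [← ENNReal.ofReal_mul (e2_nonneg x)]
        exact ENNReal.ofReal_le_ofReal (e2_mul_le x y)
    _ = (∫⁻ x, ENNReal.ofReal (e2 x) ∂a) * ∫⁻ y, ENNReal.ofReal (e2 y) ∂b :=
        lintegral_lintegral_mul (by fun_prop) (by fun_prop)
    _ < ⊤ := ENNReal.mul_lt_top ha.moment hb.moment

lemma radPos (ha : FiniteFirstMoment a) : FiniteFirstMoment (radPos a) := by
  refine ⟨⟨?_⟩, ?_⟩
  · rw [← lintegral_one, lintegral_radPos a measurable_const]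
    simpa using ha.moment
  · rw [lintegral_radPos a (by fun_prop)]
    refine lt_of_le_of_lt (lintegral_mono fun x => ?_) ha.moment
    rw [e2_smul, abs_inv, abs_of_nonneg (e2_nonneg x)]
    refine mul_le_of_le_one_right' ?_
    exact ENNReal.ofReal_le_one.2 (inv_mul_le_one)

end FiniteFirstMoment

lemma radPos_mconvPos_radPos_left {a b : Measure (Fin n → ℝ)} (ha : FiniteFirstMoment a)
    (hb : FiniteFirstMoment b) : radPos (mconvPos (radPos a) b) = radPos (mconvPos a b) := by
  have := ha.finite
  have := hb.finite
  have := ha.radPos.finite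
  refine Measure.ext_of_lintegral _ fun f hf => ?_
  have key : Measurable fun z : Fin n → ℝ => ENNReal.ofReal (e2 z) * f ((e2 z)⁻¹ • z) := by
    fun_prop
  have inner : Measurable fun x : Fin n → ℝ =>
      ∫⁻ y, ENNReal.ofReal (e2 (x * y)) * f ((e2 (x * y))⁻¹ • (x * y)) ∂b :=
    Measurable.lintegral_prod_right' (f := fun p : (Fin n → ℝ) × (Fin n → ℝ) =>
      ENNReal.ofReal (e2 (p.1 * p.2)) * f ((e2 (p.1 * p.2))⁻¹ • (p.1 * p.2))) (by fun_prop)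
  rw [lintegral_radPos _ hf, lintegral_radPos _ hf, lintegral_mconvPos _ _ key,
    lintegral_mconvPos _ _ key, lintegral_radPos _ inner]
  refine lintegral_congr fun x => ?_
  rw [← lintegral_const_mul _ (by fun_prop)]
  refine lintegral_congr fun y => ?_
  rcases eq_or_ne (e2 x) 0 with h0 | h0
  · have hx := eq_zero_of_e2_eq_zero h0
    simp [hx, e2_zero]
  · have hpos : 0 < e2 x := lt_of_le_of_ne (e2_nonneg x) h0.symm
    have hinv : |(e2 x)⁻¹| = (e2 x)⁻¹ := abs_of_pos (inv_pos.2 hpos)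
    rw [smul_mul_assoc, e2_smul, hinv, ← mul_assoc, ← ENNReal.ofReal_mul hpos.le,
      mul_inv_cancel_left₀ h0, smul_smul]
    congr 4
    field_simp

lemma radPos_mconvPos_radPos_right {a b : Measure (Fin n → ℝ)} (ha : FiniteFirstMoment a)
    (hb : FiniteFirstMoment b) : radPos (mconvPos a (radPos b)) = radPos (mconvPos a b) := by
  have := ha.finite
  have := hb.finite
  have := hb.radPos.finite
  rw [mconvPos_comm, radPos_mconvPos_radPos_left hb ha, mconvPos_comm]

end PositiveMeasures

section SignedMeasures

variable {n : ℕ}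

lemma mconv_toSigned_sub (a b c d : Measure (Fin n → ℝ)) [IsFiniteMeasure a]
    [IsFiniteMeasure b] [IsFiniteMeasure c] [IsFiniteMeasure d] :
    mconv (toSigned a - toSigned b) (toSigned c - toSigned d) =
      toSigned (mconvPos a c + mconvPos b d) - toSigned (mconvPos a d + mconvPos b c) := by
  have h₁ := add_negPart_eq a b
  have h₂ := add_negPart_eq c d
  unfold mconv
  generalize (toSigned a - toSigned b).toJordanDecomposition = j at *
  generalize (toSigned c - toSigned d).toJordanDecomposition = k at *
  trans toSigned (mconvPos a k.posPart + mconvPos b k.negPart) -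
    toSigned (mconvPos a k.negPart + mconvPos b k.posPart)
  · rw [toSigned_sub_eq_iff]
    have e₁ := congrArg (mconvPos · k.posPart) h₁
    have e₂ := congrArg (mconvPos · k.negPart) h₁
    simp only [mconvPos_add_left] at e₁ e₂
    calc _ = (mconvPos j.posPart k.posPart + mconvPos b k.posPart) +
          (mconvPos a k.negPart + mconvPos j.negPart k.negPart) := by abel
      _ = _ := by rw [← e₁, e₂]; abel
  · rw [toSigned_sub_eq_iff]
    have e₁ := congrArg (mconvPos a ·) h₂
    have e₂ := congrArg (mconvPos b ·) h₂
    simp only [mconvPos_add_right] at e₁ e₂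
    calc _ = (mconvPos a k.posPart + mconvPos a d) +
          (mconvPos b c + mconvPos b k.negPart) := by abel
      _ = _ := by rw [← e₁, e₂]; abel

lemma PS_toSigned_sub {a b : Measure (Fin n → ℝ)} (ha : FiniteFirstMoment a)
    (hb : FiniteFirstMoment b) :
    PS (toSigned a - toSigned b) = toSigned (radPos a) - toSigned (radPos b) := by
  have := ha.finite
  have := hb.finite
  have h := add_negPart_eq a b
  unfold PS
  generalize (toSigned a - toSigned b).toJordanDecomposition = j at *
  obtain ⟨hp, hm⟩ := le_of_mutuallySingular_of_add_eq j.mutuallySingular h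
  have := ha.radPos.finite
  have := hb.radPos.finite
  have := (ha.mono hp).radPos.finite
  have := (hb.mono hm).radPos.finite
  rw [toSigned_sub_eq_iff, ← radPos_add, ← radPos_add, h]

lemma IntegrableSM.exists_toSigned_sub {μ : SM n} (hμ : IntegrableSM μ) :
    ∃ a b, FiniteFirstMoment a ∧ FiniteFirstMoment b ∧ μ = toSigned a - toSigned b := by
  have h : FiniteFirstMoment μ.totalVariation := ⟨inferInstance, hμ⟩
  exact ⟨_, _, h.mono (Measure.le_add_right le_rfl), h.mono (Measure.le_add_left le_rfl),
    (toSigned_posPart_sub_negPart μ).symm⟩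

lemma PS_mconv_toSigned_sub {a b c d : Measure (Fin n → ℝ)} (ha : FiniteFirstMoment a)
    (hb : FiniteFirstMoment b) (hc : FiniteFirstMoment c) (hd : FiniteFirstMoment d) :
    PS (mconv (toSigned a - toSigned b) (toSigned c - toSigned d)) =
      toSigned (radPos (mconvPos a c) + radPos (mconvPos b d)) -
        toSigned (radPos (mconvPos a d) + radPos (mconvPos b c)) := by
  have := ha.finite
  have := hb.finite
  have := hc.finite
  have := hd.finite
  rw [mconv_toSigned_sub, PS_toSigned_sub ((ha.mconvPos hc).add (hb.mconvPos hd))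
    ((ha.mconvPos hd).add (hb.mconvPos hc)), radPos_add, radPos_add]

end SignedMeasures

/-- Theorem: `P_S(μ ⊛ ν) = P_S(P_S(μ) ⊛ ν) = P_S(μ ⊛ P_S(ν)) = P_S(P_S(μ) ⊛ P_S(ν))`. -/
theorem stmt17 {n : ℕ} (hn : 1 ≤ n) (μ ν : SM n)
    (hμ : IntegrableSM μ) (hν : IntegrableSM ν) :
    PS (mconv μ ν) = PS (mconv (PS μ) ν) ∧
    PS (mconv μ ν) = PS (mconv μ (PS ν)) ∧
    PS (mconv μ ν) = PS (mconv (PS μ) (PS ν)) := by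
  obtain ⟨a, b, ha, hb, rfl⟩ := hμ.exists_toSigned_sub
  obtain ⟨c, d, hc, hd, rfl⟩ := hν.exists_toSigned_sub
  rw [PS_toSigned_sub ha hb, PS_toSigned_sub hc hd, PS_mconv_toSigned_sub ha hb hc hd,
    PS_mconv_toSigned_sub ha.radPos hb.radPos hc hd,
    PS_mconv_toSigned_sub ha hb hc.radPos hd.radPos,
    PS_mconv_toSigned_sub ha.radPos hb.radPos hc.radPos hd.radPos]
  simp only [radPos_mconvPos_radPos_left, radPos_mconvPos_radPos_right,
    FiniteFirstMoment.radPos, ha, hb, hc, hd, and_self]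

end
end

section
/- Let A ⊆ ℝⁿ be a Borel set that is unconditional (invariant under every coordinate sign flip T_E, E ⊆ [n]). Then the map μ ↦ M_unc(μ) is a bijection from the space of measures concentrated on A ∩ ℝⁿ₊ onto the space of unconditional measures concentrated on A, and its inverse is μ ↦ g(μ), the pushforward of μ under g(x) = (|x₁|,…,|xₙ|); moreover, for every unconditional measure μ concentrated on A, g(μ) = Σ_{E⊆[n]} 2^{|E|} R₊(μ_E), where R₊(ρ)(B) = ρ(B ∩ ℝⁿ₊). -/
open MeasureTheory
open scoped ENNReal symmDiff Classical

noncomputable section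

theorem concOn_iff {n : ℕ} (μ : SM n) {A : Set (Fin n → ℝ)} (hA : MeasurableSet A) :
    ConcOn μ A ↔ ∀ B, MeasurableSet B → Disjoint B A → μ B = 0 := by
  unfold ConcOn
  rw [SignedMeasure.totalVariation_eq_variation, VectorMeasure.variation_apply_eq_zero hA.compl]
  simp only [Set.subset_compl_iff_disjoint_right]
  exact ⟨fun h B hB hd => h B hd hB, fun h B hd hB => h B hB hd⟩

/-- A measure concentrated on `A` does not distinguish sets with the same trace on `A`. -/
theorem ConcOn.apply_inter {n : ℕ} {μ : SM n} {A B : Set (Fin n → ℝ)} (h : ConcOn μ A)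
    (hA : MeasurableSet A) (hB : MeasurableSet B) : μ (B ∩ A) = μ B := by
  have h0 : μ (B \ A) = 0 :=
    (concOn_iff μ hA).1 h _ (hB.diff hA) Set.disjoint_sdiff_left
  rw [← Set.inter_union_sdiff B A, VectorMeasure.of_union
    (Set.disjoint_sdiff_right.mono_left Set.inter_subset_right) (hB.inter hA) (hB.diff hA), h0,
    add_zero, Set.inter_union_sdiff]

/-- Additivity of a vector measure over the fibres of a map to a finite type. -/
theorem sum_apply_inter_fiber {X ι M : Type*} [MeasurableSpace X] [Fintype ι] [AddCommMonoid M]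
    [TopologicalSpace M] [T2Space M] (v : VectorMeasure X M) (f : X → ι)
    (hf : ∀ i, MeasurableSet {x | f x = i}) {B : Set X} (hB : MeasurableSet B) :
    ∑ i, v (B ∩ {x | f x = i}) = v B := by
  rw [← VectorMeasure.of_biUnion_finset]
  · congr 1
    ext x
    simp
  · intro i _ j _ hij
    refine Set.disjoint_left.2 fun x hx hx' => hij ?_
    exact hx.2.symm.trans hx'.2
  · exact fun i _ => hB.inter (hf i)

theorem sum_vectorMeasure_apply {X ι M : Type*} [MeasurableSpace X] [AddCommMonoid M]
    [TopologicalSpace M] [ContinuousAdd M] (s : Finset ι) (v : ι → VectorMeasure X M) (B : Set X) :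
    (∑ i ∈ s, v i) B = ∑ i ∈ s, v i B := by
  induction s using Finset.induction_on with
  | empty => simp
  | insert a s ha ih => simp [Finset.sum_insert ha, ih]

theorem measurable_flipE {n : ℕ} (E : Finset (Fin n)) : Measurable (flipE E) := by
  refine measurable_pi_lambda _ fun i => ?_
  by_cases h : i ∈ E <;> simp only [flipE, h, if_true, if_false] <;> fun_prop

theorem flipE_flipE {n : ℕ} (E F : Finset (Fin n)) (x : Fin n → ℝ) :
    flipE E (flipE F x) = flipE (E ∆ F) x := by
  funext i
  by_cases h : i ∈ E <;> by_cases h' : i ∈ F <;> simp [flipE, Finset.mem_symmDiff, h, h']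

theorem measurable_coordAbs (n : ℕ) : Measurable fun (x : Fin n → ℝ) i => |x i| :=
  measurable_pi_lambda _ fun i => (measurable_pi_apply i).abs

theorem coordAbs_flipE {n : ℕ} (E : Finset (Fin n)) (x : Fin n → ℝ) :
    (fun i => |flipE E x i|) = fun i => |x i| := by
  funext i
  by_cases h : i ∈ E <;> simp [flipE, h]

/-- The set of coordinates at which `x` is negative. -/
def negSupport {n : ℕ} (x : Fin n → ℝ) : Finset (Fin n) := Finset.univ.filter fun i => x i < 0

theorem mem_negSupport {n : ℕ} {x : Fin n → ℝ} {i : Fin n} : i ∈ negSupport x ↔ x i < 0 := by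
  simp [negSupport]

theorem flipE_negSupport {n : ℕ} (x : Fin n → ℝ) : flipE (negSupport x) x = fun i => |x i| := by
  funext i
  by_cases h : x i < 0
  · simp [flipE, mem_negSupport, h, abs_of_neg h]
  · simp [flipE, mem_negSupport, h, abs_of_nonneg (not_lt.1 h)]

theorem measurableSet_negSupport_eq {n : ℕ} (F : Finset (Fin n)) :
    MeasurableSet {x : Fin n → ℝ | negSupport x = F} := by
  have : {x : Fin n → ℝ | negSupport x = F} = ⋂ i, {x | x i < 0 ↔ i ∈ F} := by
    ext x
    simp [Finset.ext_iff, mem_negSupport]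
  rw [this]
  refine MeasurableSet.iInter fun i => ?_
  have hi : MeasurableSet {x : Fin n → ℝ | x i < 0} :=
    measurableSet_lt (measurable_pi_apply i) measurable_const
  by_cases h : i ∈ F
  · simpa [h] using hi
  · simpa [h, Set.compl_ofPred] using hi.compl

theorem setOf_support_eq {n : ℕ} (E : Finset (Fin n)) :
    {x : Fin n → ℝ | Finset.univ.filter (fun i => x i ≠ 0) = E} = setA E := by
  ext x
  simp [setA, Finset.ext_iff]

theorem measurableSet_setA {n : ℕ} (E : Finset (Fin n)) : MeasurableSet (setA E) := by
  have : setA E = ⋂ i, {x | x i ≠ 0 ↔ i ∈ E} := by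
    ext x
    simp [setA]
  rw [this]
  refine MeasurableSet.iInter fun i => ?_
  have hi : MeasurableSet {x : Fin n → ℝ | x i = 0} :=
    measurableSet_eq_fun (measurable_pi_apply i) measurable_const
  by_cases h : i ∈ E
  · simpa [h, Set.compl_ofPred] using hi.compl
  · simpa [h] using hi

theorem measurableSet_orthant (n : ℕ) : MeasurableSet {x : Fin n → ℝ | ∀ i, 0 ≤ x i} := by
  rw [Set.ofPred_forall]
  exact MeasurableSet.iInter fun i => measurableSet_le measurable_const (measurable_pi_apply i)

theorem Tmap_apply {n : ℕ} (E : Finset (Fin n)) (μ : SM n) {B : Set (Fin n → ℝ)}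
    (hB : MeasurableSet B) : Tmap E μ B = μ (flipE E ⁻¹' B) :=
  VectorMeasure.map_apply _ (measurable_flipE E) hB

theorem Tmap_Tmap {n : ℕ} (E F : Finset (Fin n)) (μ : SM n) :
    Tmap E (Tmap F μ) = Tmap (E ∆ F) μ := by
  ext B hB
  rw [Tmap_apply _ _ hB, Tmap_apply _ _ (measurable_flipE E hB), Tmap_apply _ _ hB,
    ← Set.preimage_comp]
  congr 2
  funext x
  exact flipE_flipE E F x

theorem Munc_apply {n : ℕ} (μ : SM n) {B : Set (Fin n → ℝ)} (hB : MeasurableSet B) :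
    Munc μ B = ((2 : ℝ) ^ n)⁻¹ * ∑ E : Finset (Fin n), μ (flipE E ⁻¹' B) := by
  simp only [Munc, smul_apply, sum_vectorMeasure_apply, Tmap_apply _ _ hB,
    smul_eq_mul]

theorem Munc_eq_self {n : ℕ} {μ : SM n} (h : ∀ E : Finset (Fin n), Tmap E μ = μ) :
    Munc μ = μ := by
  ext B hB
  have hE (E : Finset (Fin n)) : μ (flipE E ⁻¹' B) = μ B := by rw [← Tmap_apply _ _ hB, h]
  simp [Munc_apply _ hB, hE]

theorem Munc_Tmap {n : ℕ} (F : Finset (Fin n)) (μ : SM n) : Munc (Tmap F μ) = Munc μ := by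
  simp only [Munc, Tmap_Tmap]
  congr 1
  exact Function.Bijective.sum_comp (e := fun E => E ∆ F)
    (symmDiff_left_involutive F).bijective fun E => Tmap E μ

theorem Munc_sum {n : ℕ} {ι : Type*} (s : Finset ι) (μ : ι → SM n) :
    Munc (∑ i ∈ s, μ i) = ∑ i ∈ s, Munc (μ i) := by
  ext B hB
  simp only [sum_vectorMeasure_apply, Munc_apply _ hB]
  rw [← Finset.mul_sum, Finset.sum_comm]

theorem Tmap_Munc {n : ℕ} (F : Finset (Fin n)) (μ : SM n) : Tmap F (Munc μ) = Munc μ := by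
  conv_rhs => rw [← Munc_Tmap F μ]
  ext B hB
  rw [Tmap_apply _ _ hB, Munc_apply _ (measurable_flipE F hB), Munc_apply _ hB]
  congr 1
  refine Finset.sum_congr rfl fun E _ => ?_
  rw [Tmap_apply _ _ (measurable_flipE E hB), ← Set.preimage_comp, ← Set.preimage_comp]
  congr 2
  funext x
  simp only [Function.comp_apply, flipE_flipE, symmDiff_comm]

theorem Munc_map_coordAbs {n : ℕ} (μ : SM n) : Munc (μ.map fun x i => |x i|) = Munc μ := by
  have hg : μ.map (fun x i => |x i|) =
      ∑ F : Finset (Fin n), Tmap F (μ.restrict {x | negSupport x = F}) := by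
    ext B hB
    rw [VectorMeasure.map_apply _ (measurable_coordAbs n) hB, sum_vectorMeasure_apply,
      ← sum_apply_inter_fiber μ negSupport measurableSet_negSupport_eq
        (measurable_coordAbs n hB)]
    refine Finset.sum_congr rfl fun F _ => ?_
    rw [Tmap_apply _ _ hB, VectorMeasure.restrict_apply _ (measurableSet_negSupport_eq F)
      (measurable_flipE F hB)]
    congr 1
    ext x
    refine and_congr_left fun hx => ?_
    simp only [Set.mem_preimage]
    rw [← flipE_negSupport, show negSupport x = F from hx]
  have hμ : μ = ∑ F : Finset (Fin n), μ.restrict {x | negSupport x = F} := by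
    ext B hB
    rw [sum_vectorMeasure_apply, ← sum_apply_inter_fiber μ negSupport
      measurableSet_negSupport_eq hB]
    exact Finset.sum_congr rfl fun F _ =>
      (VectorMeasure.restrict_apply _ (measurableSet_negSupport_eq F) hB).symm
  conv_rhs => rw [hμ]
  rw [hg, Munc_sum, Munc_sum]
  simp only [Munc_Tmap]

theorem map_coordAbs_Munc {n : ℕ} (μ : SM n) :
    (Munc μ).map (fun x i => |x i|) = μ.map fun x i => |x i| := by
  ext B hB
  have hE (E : Finset (Fin n)) :
      flipE E ⁻¹' ((fun x i => |x i|) ⁻¹' B) = (fun (x : Fin n → ℝ) i => |x i|) ⁻¹' B := by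
    ext x
    simp only [Set.mem_preimage, coordAbs_flipE]
  rw [VectorMeasure.map_apply _ (measurable_coordAbs n) hB,
    VectorMeasure.map_apply _ (measurable_coordAbs n) hB, Munc_apply _ (measurable_coordAbs n hB)]
  simp [hE]

theorem map_coordAbs_eq_self {n : ℕ} {μ : SM n} (h : ConcOn μ {x | ∀ i, 0 ≤ x i}) :
    μ.map (fun x i => |x i|) = μ := by
  ext B hB
  rw [VectorMeasure.map_apply _ (measurable_coordAbs n) hB,
    ← h.apply_inter (measurableSet_orthant n) (measurable_coordAbs n hB),
    ← h.apply_inter (measurableSet_orthant n) hB]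
  congr 1
  ext x
  refine and_congr_left fun hx => ?_
  rw [Set.mem_preimage, show (fun i => |x i|) = x from funext fun i => abs_of_nonneg (hx i)]

theorem coordAbs_mem_iff {n : ℕ} {A : Set (Fin n → ℝ)}
    (hA : ∀ E : Finset (Fin n), flipE E ⁻¹' A = A) (x : Fin n → ℝ) :
    (fun i => |x i|) ∈ A ↔ x ∈ A := by
  conv_rhs => rw [← hA (negSupport x)]
  rw [Set.mem_preimage, flipE_negSupport]

theorem ConcOn.mono {n : ℕ} {μ : SM n} {A B : Set (Fin n → ℝ)} (h : ConcOn μ A) (hAB : A ⊆ B) :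
    ConcOn μ B :=
  measure_mono_null (Set.compl_subset_compl.2 hAB) h

theorem ConcOn.Munc {n : ℕ} {μ : SM n} {A : Set (Fin n → ℝ)} (h : ConcOn μ A)
    (hA : MeasurableSet A) (hAunc : ∀ E : Finset (Fin n), flipE E ⁻¹' A = A) :
    ConcOn (Munc μ) A := by
  rw [concOn_iff _ hA] at h ⊢
  intro B hB hd
  rw [Munc_apply _ hB, Finset.sum_eq_zero, mul_zero]
  intro E _
  refine h _ (measurable_flipE E hB) ?_
  rw [← hAunc E]
  exact hd.preimage _

theorem ConcOn.map_coordAbs {n : ℕ} {μ : SM n} {A : Set (Fin n → ℝ)} (h : ConcOn μ A)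
    (hA : MeasurableSet A) (hAunc : ∀ E : Finset (Fin n), flipE E ⁻¹' A = A) :
    ConcOn (μ.map fun x i => |x i|) (A ∩ {x | ∀ i, 0 ≤ x i}) := by
  rw [concOn_iff _ (hA.inter (measurableSet_orthant n))]
  rw [concOn_iff _ hA] at h
  intro B hB hd
  rw [VectorMeasure.map_apply _ (measurable_coordAbs n) hB]
  refine h _ (measurable_coordAbs n hB) (Set.disjoint_left.2 fun x hx hxA => ?_)
  exact Set.disjoint_left.1 hd hx ⟨(coordAbs_mem_iff hAunc x).2 hxA, fun i => abs_nonneg (x i)⟩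

theorem preimage_coordAbs_inter_setA_inter {n : ℕ} {E F : Finset (Fin n)} (hFE : F ⊆ E)
    (B : Set (Fin n → ℝ)) :
    (fun (x : Fin n → ℝ) i => |x i|) ⁻¹' B ∩ setA E ∩ {x | negSupport x = F} =
      flipE F ⁻¹' (B ∩ {x | ∀ i, 0 ≤ x i} ∩ setA E) := by
  have hflip (x : Fin n → ℝ) : flipE F x ∈ setA E ↔ x ∈ setA E := by
    refine forall_congr' fun i => ?_
    by_cases hi : i ∈ F <;> simp [flipE, hi]
  ext x
  simp only [Set.mem_inter_iff, Set.mem_preimage, Set.mem_ofPred_eq, hflip]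
  constructor
  · rintro ⟨⟨hB, hE⟩, rfl⟩
    rw [flipE_negSupport]
    exact ⟨⟨hB, fun i => abs_nonneg (x i)⟩, hE⟩
  · rintro ⟨⟨hB, hpos⟩, hE⟩
    have hF : negSupport x = F := by
      ext i
      rw [mem_negSupport]
      have hi := hpos i
      by_cases hiF : i ∈ F
      · have hne : x i ≠ 0 := (hE i).2 (hFE hiF)
        simp only [flipE, hiF, if_true, Left.nonneg_neg_iff] at hi
        simp [hiF, lt_of_le_of_ne hi hne]
      · simp only [flipE, hiF, if_false] at hi
        simp [hiF, hi]
    refine ⟨⟨?_, hE⟩, hF⟩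
    rw [← flipE_negSupport, hF]
    exact hB

theorem map_coordAbs_eq_sum {n : ℕ} {μ : SM n} (h : ∀ E : Finset (Fin n), Tmap E μ = μ) :
    μ.map (fun x i => |x i|) =
      ∑ E : Finset (Fin n),
        ((2 : ℝ) ^ E.card) • ((Rres E μ).restrict {x | ∀ i, 0 ≤ x i}) := by
  ext B hB
  have hBQ := hB.inter (measurableSet_orthant n)
  rw [VectorMeasure.map_apply _ (measurable_coordAbs n) hB, sum_vectorMeasure_apply,
    ← sum_apply_inter_fiber μ (fun x => Finset.univ.filter fun i => x i ≠ 0)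
      (fun E => by rw [setOf_support_eq]; exact measurableSet_setA E) (measurable_coordAbs n hB)]
  refine Finset.sum_congr rfl fun E _ => ?_
  rw [setOf_support_eq, smul_apply,
    VectorMeasure.restrict_apply _ (measurableSet_orthant n) hB, Rres,
    VectorMeasure.restrict_apply _ (measurableSet_setA E) hBQ,
    ← sum_apply_inter_fiber μ negSupport measurableSet_negSupport_eq
      ((measurable_coordAbs n hB).inter (measurableSet_setA E)),
    ← Finset.sum_subset (Finset.subset_univ E.powerset)]
  · rw [Finset.sum_congr rfl (g := fun _ => μ (B ∩ {x | ∀ i, 0 ≤ x i} ∩ setA E))]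
    · simp
    · intro F hF
      rw [preimage_coordAbs_inter_setA_inter (Finset.mem_powerset.1 hF),
        ← Tmap_apply _ _ (hBQ.inter (measurableSet_setA E)), h]
  · intro F _ hF
    convert μ.empty
    refine Set.eq_empty_of_forall_notMem ?_
    rintro x ⟨⟨-, hE⟩, rfl⟩
    exact hF (Finset.mem_powerset.2 fun i hi => (hE i).1 (mem_negSupport.1 hi).ne)

/-- Theorem: for an unconditional Borel set `A`, `M_unc` is a bijection from the measures
concentrated on `A ∩ ℝⁿ₊` onto the unconditional measures concentrated on `A`, with inverse
the pushforward under `x ↦ (|x₁|, …, |xₙ|)`, and the inverse admits the coordinate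
decomposition `g(μ) = ∑_E 2^{|E|} R₊(μ_E)`. -/
theorem stmt19 {n : ℕ} (hn : 1 ≤ n) (A : Set (Fin n → ℝ)) (hA : MeasurableSet A)
    (hAunc : ∀ E : Finset (Fin n), (flipE E) ⁻¹' A = A) :
    Set.BijOn Munc {μ : SM n | ConcOn μ (A ∩ {x | ∀ i, 0 ≤ x i})}
      {μ : SM n | ConcOn μ A ∧ ∀ E : Finset (Fin n), Tmap E μ = μ} ∧
    Set.InvOn (fun μ : SM n => μ.map (fun x i => |x i|)) Munc
      {μ : SM n | ConcOn μ (A ∩ {x | ∀ i, 0 ≤ x i})}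
      {μ : SM n | ConcOn μ A ∧ ∀ E : Finset (Fin n), Tmap E μ = μ} ∧
    ∀ μ : SM n, ConcOn μ A → (∀ E : Finset (Fin n), Tmap E μ = μ) →
      μ.map (fun x i => |x i|) =
        ∑ E : Finset (Fin n),
          ((2 : ℝ) ^ E.card) • ((Rres E μ).restrict {x | ∀ i, 0 ≤ x i}) := by
  have hinv : Set.InvOn (fun μ : SM n => μ.map (fun x i => |x i|)) Munc
      {μ : SM n | ConcOn μ (A ∩ {x | ∀ i, 0 ≤ x i})}
      {μ : SM n | ConcOn μ A ∧ ∀ E : Finset (Fin n), Tmap E μ = μ} := by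
    refine ⟨fun μ hμ => ?_, fun μ hμ => ?_⟩
    · exact (map_coordAbs_Munc μ).trans
        (map_coordAbs_eq_self (ConcOn.mono hμ Set.inter_subset_right))
    · exact (Munc_map_coordAbs μ).trans (Munc_eq_self hμ.2)
  refine ⟨hinv.bijOn (fun μ hμ => ?_) (fun μ hμ => ?_), hinv, fun μ _ h => map_coordAbs_eq_sum h⟩
  · exact ⟨(ConcOn.mono hμ Set.inter_subset_left).Munc hA hAunc, fun E => Tmap_Munc E μ⟩
  · exact hμ.1.map_coordAbs hA hAunc

end
end
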